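/- arXiv:2404.11880 — 2 statements merged into one kernel-verified Lean document; each statement's English description precedes it below -/
import Mathlib

section
/- Assume S_U ⊆ (0, ∞) and S_L ⊆ (0, ∞), and let α ∈ ℝ. Then Σ_{j=1}^k w_j Φ(f(A_j)) ≤ α·log(B_U) + ( max_{x ∈ S_U} (x − α·log x) )·1_K, and Σ_{j=1}^k w_j Φ(f(A_j)) ≥ α·log(B_L) + ( min_{x ∈ S_L} (x − α·log x) )·1_K, in the Loewner order, where log is applied to B_U and B_L via continuous functional calculus and 1_K is the identity operator on K. -/
open ContinuousLinearMap in
/-- The Kantorovich constant `K(m', M', r)`, with the convention that it equals `1`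
for `r = 0` and `r = 1`. -/
noncomputable def kantorovich (m M r : ℝ) : ℝ :=
  if r = 0 ∨ r = 1 then 1 else
    ((m * M ^ r - M * m ^ r) / ((r - 1) * (M - m))) *
      (((r - 1) * (M ^ r - m ^ r)) / (r * (m * M ^ r - M * m ^ r))) ^ r

open ContinuousLinearMap Polynomial

/-- The Kantorovich constant is the largest ratio of the chord of `x ↦ x ^ n` over `[m, M]` to
`x ^ n`; the ratio at `M` is `1`. -/
theorem one_le_kantorovich {m M : ℝ} (hm : 0 < m) (hmM : m < M) (n : ℕ) :
    1 ≤ kantorovich m M n := by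
  unfold kantorovich
  split_ifs with h
  · exact le_rfl
  push Not at h
  have hn : 2 ≤ n := by
    have h0 : n ≠ 0 := by exact_mod_cast h.1
    have h1 : n ≠ 1 := by exact_mod_cast h.2
    omega
  simp only [Real.rpow_natCast]
  have hM : 0 < M := hm.trans hmM
  have hr : (0 : ℝ) < n - 1 := by
    have : (2 : ℝ) ≤ n := by exact_mod_cast hn
    linarith
  have hr0 : (0 : ℝ) < n := by linarith
  have hd : 0 < M ^ n - m ^ n := sub_pos.2 (pow_lt_pow_left₀ hmM hm.le (by omega))
  have hc : 0 < m * M ^ n - M * m ^ n := by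
    obtain ⟨p, rfl⟩ : ∃ p, n = p + 1 := ⟨n - 1, by omega⟩
    have hp : m ^ p < M ^ p := pow_lt_pow_left₀ hmM hm.le (by omega)
    have : m * M ^ (p + 1) - M * m ^ (p + 1) = m * M * (M ^ p - m ^ p) := by ring
    rw [this]
    exact mul_pos (mul_pos hm hM) (sub_pos.2 hp)
  set d := M ^ n - m ^ n with hd_def
  set c := m * M ^ n - M * m ^ n with hc_def
  set y := ((n : ℝ) - 1) * d / (n * c) with hy
  have hypos : 0 < y := by positivity
  have hbern := one_add_mul_le_pow (a := M * y - 1) (by nlinarith [mul_pos hM hypos]) n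
  rw [add_sub_cancel, mul_pow] at hbern
  have hchord : (M - m) * M ^ n = d * M - c := by rw [hd_def, hc_def]; ring
  have hny : n * c * y = (n - 1) * d := by rw [hy]; field_simp
  have hMn : 0 < M ^ n := by positivity
  have key : (n - 1) * (M - m) * M ^ n ≤ c * y ^ n * M ^ n := by
    calc (n - 1) * (M - m) * M ^ n = c * (1 + n * (M * y - 1)) := by
          linear_combination (n - 1) * hchord - M * hny
      _ ≤ c * (M ^ n * y ^ n) := mul_le_mul_of_nonneg_left hbern hc.le
      _ = c * y ^ n * M ^ n := by ring
  have hkey := le_of_mul_le_mul_right key hMn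
  have hden : 0 < ((n : ℝ) - 1) * (M - m) := mul_pos hr (sub_pos.2 hmM)
  rw [div_mul_eq_mul_div, le_div_iff₀ hden, one_mul]
  exact hkey

/-- The Kantorovich constants of a polynomial that is positive and nonconstant on an interval are
at least `1`. -/
theorem one_le_kantorovich_sInf_sSup {p : Polynomial ℝ} {m M : ℝ} (hmM : m ≤ M)
    (hpos : ∀ x ∈ Set.Icc m M, 0 < p.eval x)
    (hlt : sInf ((fun x => p.eval x) '' Set.Icc m M) < sSup ((fun x => p.eval x) '' Set.Icc m M))
    (n : ℕ) :
    1 ≤ kantorovich (sInf ((fun x => p.eval x) '' Set.Icc m M))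
      (sSup ((fun x => p.eval x) '' Set.Icc m M)) n := by
  refine one_le_kantorovich ?_ hlt n
  obtain ⟨x, hx, hxe⟩ := (isCompact_Icc.image p.continuous).sInf_mem
    ((Set.nonempty_Icc.2 hmM).image (fun x => p.eval x))
  rw [← hxe]
  exact hpos x hx

/-- Bounding a polynomial expression in `y` by splitting according to the signs of the
coefficients. -/
theorem sum_mul_pow_le_sum_filter {N : ℕ} {a κ κ' : ℕ → ℝ} {l y u : ℝ}
    (hl : 0 < l) (hly : l ≤ y) (hyu : y ≤ u) (hκ : ∀ i, 1 ≤ κ i) (hκ' : ∀ i, 1 ≤ κ' i) :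
    ∑ i ∈ Finset.range N, a i * y ^ i ≤
      (∑ i ∈ (Finset.range N).filter (fun i => 0 ≤ a i), a i * κ i * u ^ i) +
        ∑ i ∈ (Finset.range N).filter (fun i => a i < 0), a i * (κ' i)⁻¹ * l ^ i := by
  have hy : 0 < y := hl.trans_le hly
  rw [← Finset.sum_filter_add_sum_filter_not (Finset.range N) (fun i => 0 ≤ a i)]
  simp only [not_le]
  refine add_le_add (Finset.sum_le_sum fun i hi => ?_) (Finset.sum_le_sum fun i hi => ?_)
  · have ha := (Finset.mem_filter.1 hi).2
    rw [mul_assoc]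
    refine mul_le_mul_of_nonneg_left ?_ ha
    calc y ^ i ≤ u ^ i := pow_le_pow_left₀ hy.le hyu i
      _ ≤ κ i * u ^ i :=
        le_mul_of_one_le_left (pow_nonneg (hy.le.trans hyu) i) (hκ i)
  · have ha := (Finset.mem_filter.1 hi).2
    rw [mul_assoc]
    refine mul_le_mul_of_nonpos_left ?_ ha.le
    calc (κ' i)⁻¹ * l ^ i ≤ l ^ i :=
        mul_le_of_le_one_left (pow_nonneg hl.le i) (inv_le_one_of_one_le₀ (hκ' i))
      _ ≤ y ^ i := pow_le_pow_left₀ hl.le hly i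

/-- The lower counterpart of `sum_mul_pow_le_sum_filter`. -/
theorem sum_filter_le_sum_mul_pow {N : ℕ} {a κ κ' : ℕ → ℝ} {l y u : ℝ}
    (hl : 0 < l) (hly : l ≤ y) (hyu : y ≤ u) (hκ : ∀ i, 1 ≤ κ i) (hκ' : ∀ i, 1 ≤ κ' i) :
    (∑ i ∈ (Finset.range N).filter (fun i => 0 ≤ a i), a i * (κ' i)⁻¹ * l ^ i) +
        ∑ i ∈ (Finset.range N).filter (fun i => a i < 0), a i * κ i * u ^ i ≤
      ∑ i ∈ Finset.range N, a i * y ^ i := by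
  have hy : 0 < y := hl.trans_le hly
  rw [← Finset.sum_filter_add_sum_filter_not (Finset.range N) (fun i => 0 ≤ a i)]
  simp only [not_le]
  refine add_le_add (Finset.sum_le_sum fun i hi => ?_) (Finset.sum_le_sum fun i hi => ?_)
  · have ha := (Finset.mem_filter.1 hi).2
    rw [mul_assoc]
    refine mul_le_mul_of_nonneg_left ?_ ha
    calc (κ' i)⁻¹ * l ^ i ≤ l ^ i :=
        mul_le_of_le_one_left (pow_nonneg hl.le i) (inv_le_one_of_one_le₀ (hκ' i))
      _ ≤ y ^ i := pow_le_pow_left₀ hl.le hly i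
  · have ha := (Finset.mem_filter.1 hi).2
    rw [mul_assoc]
    refine mul_le_mul_of_nonpos_left ?_ ha.le
    calc y ^ i ≤ u ^ i := pow_le_pow_left₀ hy.le hyu i
      _ ≤ κ i * u ^ i :=
        le_mul_of_one_le_left (pow_nonneg (hy.le.trans hyu) i) (hκ i)

section Operators

variable {H K : Type*} [NormedAddCommGroup H] [InnerProductSpace ℂ H] [CompleteSpace H]
  [NormedAddCommGroup K] [InnerProductSpace ℂ K] [CompleteSpace K]

theorem sum_smul_adjoint_conj_mono {k : ℕ} (V : K →L[ℂ] H) {w : Fin k → ℝ} (hw : ∀ j, 0 ≤ w j)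
    {S T : Fin k → H →L[ℂ] H} (h : ∀ j, S j ≤ T j) :
    ∑ j, w j • (adjoint V ∘L S j ∘L V) ≤ ∑ j, w j • (adjoint V ∘L T j ∘L V) := by
  refine Finset.sum_le_sum fun j _ => smul_le_smul_of_nonneg_left ?_ (hw j)
  rw [ContinuousLinearMap.le_def]
  have := (ContinuousLinearMap.le_def _ _).1 (h j)
  simpa [ContinuousLinearMap.sub_comp, ContinuousLinearMap.comp_sub] using this.adjoint_conj V

theorem sum_smul_adjoint_conj_algebraMap {k : ℕ} {V : K →L[ℂ] H} (hV : adjoint V ∘L V = 1)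
    {w : Fin k → ℝ} (hw1 : ∑ j, w j = 1) (c : ℝ) :
    ∑ j, w j • (adjoint V ∘L algebraMap ℝ (H →L[ℂ] H) c ∘L V) =
      algebraMap ℝ (K →L[ℂ] K) c := by
  have h : adjoint V ∘L algebraMap ℝ (H →L[ℂ] H) c ∘L V = algebraMap ℝ (K →L[ℂ] K) c := by
    rw [Algebra.algebraMap_eq_smul_one, Algebra.algebraMap_eq_smul_one, ← hV]
    ext x
    simp
  simp only [h]
  rw [← Finset.sum_smul, hw1, one_smul]

theorem sum_smul_pow_cfc {A : H →L[ℂ] H} (hA : IsSelfAdjoint A) {f : ℝ → ℝ}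
    (hf : ContinuousOn f (spectrum ℝ A)) (a : ℕ → ℝ) (N : ℕ) :
    ∑ i ∈ Finset.range N, a i • (cfc f A) ^ i =
      cfc (fun x => ∑ i ∈ Finset.range N, a i * f x ^ i) A := by
  have hsum : cfc (fun x => ∑ i ∈ Finset.range N, a i * f x ^ i) A =
      ∑ i ∈ Finset.range N, cfc (fun x => a i * f x ^ i) A := by
    rw [← cfc_sum (fun i x => a i * f x ^ i) A (Finset.range N) (fun i _ => by fun_prop)]
    congr 1
    ext x
    simp
  rw [hsum]
  refine Finset.sum_congr rfl fun i _ => ?_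
  rw [cfc_const_mul (a i) (fun x => f x ^ i) A, cfc_pow f i A]

/-- An average of compressions of the `q j (A j)` is self-adjoint with spectrum in the closed convex
hull of the ranges of the `q j`, which is compact. -/
theorem isCompact_and_spectrum_sum_smul_adjoint_conj_cfc_subset {k : ℕ} (hk : 1 ≤ k)
    {V : K →L[ℂ] H} (hV : adjoint V ∘L V = 1) {w : Fin k → ℝ} (hw : ∀ j, 0 ≤ w j)
    (hw1 : ∑ j, w j = 1) {m M : Fin k → ℝ} (hmM : ∀ j, m j < M j) {A : Fin k → H →L[ℂ] H}
    (hA : ∀ j, IsSelfAdjoint (A j)) (hspec : ∀ j, spectrum ℝ (A j) ⊆ Set.Icc (m j) (M j))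
    {q : Fin k → ℝ → ℝ} (hq : ∀ j, Continuous (q j)) :
    let S := closure (convexHull ℝ (⋃ j, q j '' Set.Icc (m j) (M j)))
    let B := ∑ j, w j • (adjoint V ∘L cfc (q j) (A j) ∘L V)
    IsCompact S ∧ IsSelfAdjoint B ∧ spectrum ℝ B ⊆ S := by
  intro S B
  have hcpt : IsCompact S :=
    (isBounded_convexHull.2 (isCompact_iUnion fun j =>
      isCompact_Icc.image (hq j)).isBounded).isCompact_closure
  have hsub : ∀ j, ∀ x ∈ Set.Icc (m j) (M j), q j x ∈ S := fun j x hx =>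
    subset_closure (subset_convexHull ℝ _ (Set.mem_iUnion.2 ⟨j, x, hx, rfl⟩))
  have hne : S.Nonempty :=
    ⟨_, hsub ⟨0, hk⟩ (m ⟨0, hk⟩) (Set.left_mem_Icc.2 (hmM _).le)⟩
  have hIcc : S = Set.Icc (sInf S) (sSup S) :=
    eq_Icc_of_connected_compact
      ⟨hne, (convex_convexHull ℝ _).closure.isPreconnected⟩ hcpt
  have hB : IsSelfAdjoint B := by
    refine isSelfAdjoint_sum _ fun j _ => IsSelfAdjoint.smul (.all _) ?_
    exact (cfc_predicate (q j) (A j)).adjoint_conj V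
  refine ⟨hcpt, hB, ?_⟩
  have hlo : algebraMap ℝ (K →L[ℂ] K) (sInf S) ≤ B := by
    rw [← sum_smul_adjoint_conj_algebraMap hV hw1]
    refine sum_smul_adjoint_conj_mono V hw fun j => ?_
    refine algebraMap_le_cfc _ _ _ (fun x hx => ?_) (hq j).continuousOn (hA j)
    exact (hIcc ▸ hsub j x (hspec j hx) : q j x ∈ Set.Icc (sInf S) (sSup S)).1
  have hhi : B ≤ algebraMap ℝ (K →L[ℂ] K) (sSup S) := by
    rw [← sum_smul_adjoint_conj_algebraMap hV hw1]
    refine sum_smul_adjoint_conj_mono V hw fun j => ?_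
    refine cfc_le_algebraMap _ _ _ (fun x hx => ?_) (hq j).continuousOn (hA j)
    exact (hIcc ▸ hsub j x (hspec j hx) : q j x ∈ Set.Icc (sInf S) (sSup S)).2
  intro x hx
  rw [hIcc]
  exact ⟨(algebraMap_le_iff_le_spectrum hB).1 hlo x hx,
    (le_algebraMap_iff_spectrum_le hB).1 hhi x hx⟩

theorem smul_cfc_log_add_smul_one {B : K →L[ℂ] K} (hB : IsSelfAdjoint B)
    (hpos : spectrum ℝ B ⊆ Set.Ioi 0) (α c : ℝ) :
    α • cfc Real.log B + c • (1 : K →L[ℂ] K) = cfc (fun x => α * Real.log x + c) B := by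
  have hlog : ContinuousOn Real.log (spectrum ℝ B) :=
    Real.continuousOn_log.mono fun x hx => (hpos hx).ne'
  rw [← Algebra.algebraMap_eq_smul_one, cfc_add_const c (fun x => α * Real.log x) B,
    cfc_const_mul α Real.log B]

theorem continuousOn_sub_mul_log {S : Set ℝ} (hS : S ⊆ Set.Ioi 0) (α : ℝ) :
    ContinuousOn (fun x => x - α * Real.log x) S :=
  continuousOn_id.sub (continuousOn_const.mul
    (Real.continuousOn_log.mono fun _ hx => (hS hx).ne'))

theorem le_smul_cfc_log_add_sSup {B : K →L[ℂ] K} (hB : IsSelfAdjoint B) {S : Set ℝ}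
    (hS : IsCompact S) (hpos : S ⊆ Set.Ioi 0) (hBS : spectrum ℝ B ⊆ S) (α : ℝ) :
    B ≤ α • cfc Real.log B + sSup ((fun x => x - α * Real.log x) '' S) • (1 : K →L[ℂ] K) := by
  have hlog : ContinuousOn Real.log (spectrum ℝ B) :=
    Real.continuousOn_log.mono fun x hx => (hpos (hBS hx)).ne'
  rw [smul_cfc_log_add_smul_one hB (hBS.trans hpos)]
  nth_rewrite 1 [← cfc_id' ℝ B]
  refine cfc_mono fun x hx => ?_
  have := le_csSup (hS.image_of_continuousOn (continuousOn_sub_mul_log hpos α)).bddAbove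
    (Set.mem_image_of_mem _ (hBS hx))
  linarith

theorem smul_cfc_log_add_sInf_le {B : K →L[ℂ] K} (hB : IsSelfAdjoint B) {S : Set ℝ}
    (hS : IsCompact S) (hpos : S ⊆ Set.Ioi 0) (hBS : spectrum ℝ B ⊆ S) (α : ℝ) :
    α • cfc Real.log B + sInf ((fun x => x - α * Real.log x) '' S) • (1 : K →L[ℂ] K) ≤ B := by
  have hlog : ContinuousOn Real.log (spectrum ℝ B) :=
    Real.continuousOn_log.mono fun x hx => (hpos (hBS hx)).ne'
  rw [smul_cfc_log_add_smul_one hB (hBS.trans hpos)]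
  nth_rewrite 2 [← cfc_id' ℝ B]
  refine cfc_mono fun x hx => ?_
  have := csInf_le (hS.image_of_continuousOn (continuousOn_sub_mul_log hpos α)).bddBelow
    (Set.mem_image_of_mem _ (hBS hx))
  linarith

end Operators

theorem stmt5
    {H K : Type*} [NormedAddCommGroup H] [InnerProductSpace ℂ H] [CompleteSpace H]
    [NormedAddCommGroup K] [InnerProductSpace ℂ K] [CompleteSpace K]
    (V : K →L[ℂ] H) (hV : (adjoint V) ∘L V = 1)
    (I : ℕ) (a : ℕ → ℝ)
    (k : ℕ) (hk : 1 ≤ k)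
    (w : Fin k → ℝ) (hw : ∀ j, 0 ≤ w j) (hw1 : ∑ j, w j = 1)
    (m M : Fin k → ℝ) (hmM : ∀ j, m j < M j)
    (A : Fin k → H →L[ℂ] H) (hA : ∀ j, IsSelfAdjoint (A j))
    (hspec : ∀ j, spectrum ℝ (A j) ⊆ Set.Icc (m j) (M j))
    (f : ℝ → ℝ) (hf : ContinuousOn f (⋃ j, Set.Icc (m j) (M j)))
    (pL pU : Polynomial ℝ)
    (hp : ∀ x ∈ ⋃ j, Set.Icc (m j) (M j),
      0 < pL.eval x ∧ pL.eval x ≤ f x ∧ f x ≤ pU.eval x)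
    (mU MU mL ML : Fin k → ℝ)
    (hmU : ∀ j, mU j = sInf ((fun x => pU.eval x) '' Set.Icc (m j) (M j)))
    (hMU : ∀ j, MU j = sSup ((fun x => pU.eval x) '' Set.Icc (m j) (M j)))
    (hmL : ∀ j, mL j = sInf ((fun x => pL.eval x) '' Set.Icc (m j) (M j)))
    (hML : ∀ j, ML j = sSup ((fun x => pL.eval x) '' Set.Icc (m j) (M j)))
    (hUlt : ∀ j, mU j < MU j) (hLlt : ∀ j, mL j < ML j)
    (qU qL : Fin k → ℝ → ℝ)
    (hqU : ∀ j x, qU j x =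
      (∑ i ∈ (Finset.range (I + 1)).filter (fun i => 0 ≤ a i),
        a i * kantorovich (mU j) (MU j) (i : ℝ) * (pU.eval x) ^ i) +
      ∑ i ∈ (Finset.range (I + 1)).filter (fun i => a i < 0),
        a i * (kantorovich (mL j) (ML j) (i : ℝ))⁻¹ * (pL.eval x) ^ i)
    (hqL : ∀ j x, qL j x =
      (∑ i ∈ (Finset.range (I + 1)).filter (fun i => 0 ≤ a i),
        a i * (kantorovich (mL j) (ML j) (i : ℝ))⁻¹ * (pL.eval x) ^ i) +
      ∑ i ∈ (Finset.range (I + 1)).filter (fun i => a i < 0),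
        a i * kantorovich (mU j) (MU j) (i : ℝ) * (pU.eval x) ^ i)
    (BU BL : K →L[ℂ] K)
    (hBU : BU = ∑ j, w j • ((adjoint V) ∘L (cfc (qU j) (A j)) ∘L V))
    (hBL : BL = ∑ j, w j • ((adjoint V) ∘L (cfc (qL j) (A j)) ∘L V))
    (SU SL : Set ℝ)
    (hSU : SU = closure (convexHull ℝ (⋃ j, qU j '' Set.Icc (m j) (M j))))
    (hSL : SL = closure (convexHull ℝ (⋃ j, qL j '' Set.Icc (m j) (M j))))
    (hSUpos : SU ⊆ Set.Ioi (0 : ℝ)) (hSLpos : SL ⊆ Set.Ioi (0 : ℝ))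
    (α : ℝ) :
    ((∑ j, w j • ((adjoint V) ∘L (∑ i ∈ Finset.range (I + 1), a i • (cfc f (A j)) ^ i) ∘L V)) ≤
      α • cfc Real.log BU + (sSup ((fun x => x - α * Real.log x) '' SU)) • (1 : K →L[ℂ] K)) ∧
    α • cfc Real.log BL + (sInf ((fun x => x - α * Real.log x) '' SL)) • (1 : K →L[ℂ] K) ≤
      (∑ j, w j • ((adjoint V) ∘L (∑ i ∈ Finset.range (I + 1), a i • (cfc f (A j)) ^ i) ∘L V)) := by
  have hmem : ∀ {j x}, x ∈ Set.Icc (m j) (M j) → x ∈ ⋃ j, Set.Icc (m j) (M j) :=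
    fun {j} {_} hx => Set.mem_iUnion.2 ⟨j, hx⟩
  have hκU : ∀ j (i : ℕ), 1 ≤ kantorovich (mU j) (MU j) i := fun j i => by
    have hlt := hUlt j
    rw [hmU j, hMU j] at hlt ⊢
    refine one_le_kantorovich_sInf_sSup (hmM j).le (fun x hx => ?_) hlt i
    obtain ⟨h1, h2, h3⟩ := hp x (hmem hx)
    exact h1.trans_le (h2.trans h3)
  have hκL : ∀ j (i : ℕ), 1 ≤ kantorovich (mL j) (ML j) i := fun j i => by
    have hlt := hLlt j
    rw [hmL j, hML j] at hlt ⊢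
    exact one_le_kantorovich_sInf_sSup (hmM j).le (fun x hx => (hp x (hmem hx)).1) hlt i
  have hcU : ∀ j, Continuous (qU j) := fun j => by
    rw [funext (hqU j)]
    fun_prop
  have hcL : ∀ j, Continuous (qL j) := fun j => by
    rw [funext (hqL j)]
    fun_prop
  have hfA : ∀ j, ContinuousOn f (spectrum ℝ (A j)) := fun j =>
    hf.mono fun x hx => hmem (hspec j hx)
  obtain ⟨hSUc, hBUsa, hBUS⟩ :=
    isCompact_and_spectrum_sum_smul_adjoint_conj_cfc_subset hk hV hw hw1 hmM hA hspec hcU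
  obtain ⟨hSLc, hBLsa, hBLS⟩ :=
    isCompact_and_spectrum_sum_smul_adjoint_conj_cfc_subset hk hV hw hw1 hmM hA hspec hcL
  rw [← hBU] at hBUsa hBUS
  rw [← hBL] at hBLsa hBLS
  rw [← hSU] at hSUc hBUS
  rw [← hSL] at hSLc hBLS
  constructor
  · refine le_trans ?_ (le_smul_cfc_log_add_sSup hBUsa hSUc hSUpos hBUS α)
    rw [hBU]
    refine sum_smul_adjoint_conj_mono V hw fun j => ?_
    have hfj := hfA j
    rw [sum_smul_pow_cfc (hA j) hfj]
    refine cfc_mono (fun x hx => ?_) (by fun_prop) (hcU j).continuousOn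
    obtain ⟨h1, h2, h3⟩ := hp x (hmem (hspec j hx))
    rw [hqU]
    exact sum_mul_pow_le_sum_filter h1 h2 h3 (hκU j) (hκL j)
  · refine le_trans (smul_cfc_log_add_sInf_le hBLsa hSLc hSLpos hBLS α) ?_
    rw [hBL]
    refine sum_smul_adjoint_conj_mono V hw fun j => ?_
    have hfj := hfA j
    rw [sum_smul_pow_cfc (hA j) hfj]
    refine cfc_mono (fun x hx => ?_) (hcL j).continuousOn (by fun_prop)
    obtain ⟨h1, h2, h3⟩ := hp x (hmem (hspec j hx))
    rw [hqL]
    exact sum_filter_le_sum_mul_pow h1 h2 h3 (hκU j) (hκL j)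
end

section
/- Let g be a continuous real function on S_U with g(x) > 0 for all x ∈ S_U. Then Σ_{j=1}^k w_j Φ(f(A_j)) ≤ ( max_{x ∈ S_U} x/g(x) )·g(B_U) in the Loewner order, where g(B_U) is defined by continuous functional calculus. -/
open ContinuousLinearMap Polynomial

/-- The Kantorovich constant is at least `1` for exponents `r > 1`. -/
theorem one_le_kantorovich_of_one_lt {m M r : ℝ} (hm : 0 < m) (hmM : m < M) (hr : 1 < r) :
    1 ≤ kantorovich m M r := by
  have hM : 0 < M := hm.trans hmM
  have hr0 : 0 < r - 1 := sub_pos.2 hr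
  have hd : 0 < M - m := sub_pos.2 hmM
  have hα : 0 < M ^ r - m ^ r := sub_pos.2 (Real.rpow_lt_rpow hm.le hmM (by linarith))
  have hb : 0 < m * M ^ r - M * m ^ r := by
    have hMr : M ^ r = M ^ (r - 1) * M := by
      rw [← Real.rpow_add_one hM.ne', sub_add_cancel]
    have hmr : m ^ r = m ^ (r - 1) * m := by
      rw [← Real.rpow_add_one hm.ne', sub_add_cancel]
    have hlt : m ^ (r - 1) < M ^ (r - 1) := Real.rpow_lt_rpow hm.le hmM hr0
    rw [hMr, hmr]
    nlinarith [mul_pos hm hM]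
  rw [kantorovich, if_neg (by rintro (h | h) <;> linarith)]
  set b := m * M ^ r - M * m ^ r with hbdef
  have hs : 0 < (r - 1) * (M ^ r - m ^ r) / (r * b) := by positivity
  have hbern := one_add_mul_self_le_rpow_one_add
    (s := (r - 1) * (M ^ r - m ^ r) / (r * b) * m - 1)
    (by linarith [mul_pos hs hm]) hr.le
  rw [add_sub_cancel, Real.mul_rpow hs.le hm.le] at hbern
  have hmr : 0 < m ^ r := Real.rpow_pos_of_pos hm r
  refine le_of_mul_le_mul_right ?_ hmr
  calc 1 * m ^ r
      = b / ((r - 1) * (M - m)) *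
          (1 + r * ((r - 1) * (M ^ r - m ^ r) / (r * b) * m - 1)) := by
        field_simp
        rw [hbdef]
        ring
    _ ≤ b / ((r - 1) * (M - m)) * (((r - 1) * (M ^ r - m ^ r) / (r * b)) ^ r * m ^ r) := by
        gcongr
    _ = _ := by ring

theorem one_le_kantorovich_natCast {m M : ℝ} (hm : 0 < m) (hmM : m < M) (i : ℕ) :
    1 ≤ kantorovich m M i := by
  rcases i with _ | _ | i
  · simp [kantorovich]
  · simp [kantorovich]
  · exact one_le_kantorovich_of_one_lt hm hmM (by push_cast; linarith [i.cast_nonneg (α := ℝ)])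

theorem sInf_eval_image_Icc_pos {p : ℝ[X]} {m M : ℝ} (hmM : m ≤ M)
    (hp : ∀ x ∈ Set.Icc m M, 0 < p.eval x) :
    0 < sInf ((fun x => p.eval x) '' Set.Icc m M) := by
  obtain ⟨x, hx, hx'⟩ := (isCompact_Icc.image p.continuous).sInf_mem
    ((Set.nonempty_Icc.2 hmM).image _)
  rw [← hx']
  exact hp x hx

section Compression

variable {H K : Type*} [NormedAddCommGroup H] [InnerProductSpace ℂ H] [CompleteSpace H]
  [NormedAddCommGroup K] [InnerProductSpace ℂ K] [CompleteSpace K]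

theorem adjoint_comp_comp_mono (V : K →L[ℂ] H) {S T : H →L[ℂ] H} (h : S ≤ T) :
    (adjoint V) ∘L S ∘L V ≤ (adjoint V) ∘L T ∘L V := by
  rw [ContinuousLinearMap.le_def] at h ⊢
  simpa [ContinuousLinearMap.comp_sub, ContinuousLinearMap.sub_comp] using h.adjoint_conj V

theorem sum_smul_adjoint_comp_comp_mono {ι : Type*} (s : Finset ι) (V : K →L[ℂ] H)
    {w : ι → ℝ} (hw : ∀ j, 0 ≤ w j) {S T : ι → H →L[ℂ] H} (h : ∀ j, S j ≤ T j) :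
    ∑ j ∈ s, w j • ((adjoint V) ∘L S j ∘L V) ≤ ∑ j ∈ s, w j • ((adjoint V) ∘L T j ∘L V) :=
  Finset.sum_le_sum fun j _ =>
    smul_le_smul_of_nonneg_left (adjoint_comp_comp_mono V (h j)) (hw j)

theorem sum_smul_adjoint_comp_algebraMap_comp {ι : Type*} (s : Finset ι) (V : K →L[ℂ] H)
    (hV : (adjoint V) ∘L V = 1) {w : ι → ℝ} (hw1 : ∑ j ∈ s, w j = 1) (c : ℝ) :
    ∑ j ∈ s, w j • ((adjoint V) ∘L (algebraMap ℝ (H →L[ℂ] H) c) ∘L V) =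
      algebraMap ℝ (K →L[ℂ] K) c := by
  have h : (adjoint V) ∘L (algebraMap ℝ (H →L[ℂ] H) c) ∘L V = algebraMap ℝ (K →L[ℂ] K) c := by
    rw [Algebra.algebraMap_eq_smul_one, Algebra.algebraMap_eq_smul_one, ← hV]
    ext x
    simp [← Complex.coe_smul]
  simp_rw [h]
  rw [← Finset.sum_smul, hw1, one_smul]

theorem isSelfAdjoint_sum_smul_adjoint_comp_comp {ι : Type*} (s : Finset ι) (V : K →L[ℂ] H)
    (w : ι → ℝ) {T : ι → H →L[ℂ] H} (hT : ∀ j, IsSelfAdjoint (T j)) :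
    IsSelfAdjoint (∑ j ∈ s, w j • ((adjoint V) ∘L T j ∘L V)) :=
  isSelfAdjoint_sum s fun j _ =>
    IsSelfAdjoint.smul (IsSelfAdjoint.all (w j)) (IsSelfAdjoint.adjoint_conj (hT j) V)

/-- A convex combination of compressions by an isometry has spectrum in any compact interval
bounding the compressed operators. -/
theorem spectrum_sum_smul_adjoint_comp_comp_subset_Icc {ι : Type*} (s : Finset ι)
    (V : K →L[ℂ] H) (hV : (adjoint V) ∘L V = 1) {w : ι → ℝ} (hw : ∀ j, 0 ≤ w j)
    (hw1 : ∑ j ∈ s, w j = 1) {T : ι → H →L[ℂ] H} (hT : ∀ j, IsSelfAdjoint (T j)) {α β : ℝ}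
    (hα : ∀ j, algebraMap ℝ (H →L[ℂ] H) α ≤ T j)
    (hβ : ∀ j, T j ≤ algebraMap ℝ (H →L[ℂ] H) β) :
    spectrum ℝ (∑ j ∈ s, w j • ((adjoint V) ∘L T j ∘L V)) ⊆ Set.Icc α β := by
  have hsa := isSelfAdjoint_sum_smul_adjoint_comp_comp s V w hT
  have h1 := sum_smul_adjoint_comp_comp_mono s V hw hα
  have h2 := sum_smul_adjoint_comp_comp_mono s V hw hβ
  rw [sum_smul_adjoint_comp_algebraMap_comp s V hV hw1] at h1 h2
  exact fun x hx => ⟨(algebraMap_le_iff_le_spectrum (ha := hsa)).1 h1 x hx,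
    (le_algebraMap_iff_spectrum_le (ha := hsa)).1 h2 x hx⟩

end Compression

theorem sum_smul_cfc_pow {H : Type*} [NormedAddCommGroup H] [InnerProductSpace ℂ H]
    [CompleteSpace H] {A : H →L[ℂ] H} (hA : IsSelfAdjoint A) {f : ℝ → ℝ}
    (hf : ContinuousOn f (spectrum ℝ A)) (s : Finset ℕ) (a : ℕ → ℝ) :
    ∑ i ∈ s, a i • (cfc f A) ^ i = cfc (fun x => ∑ i ∈ s, a i * f x ^ i) A := by
  have h := cfc_sum (fun i x => a i * f x ^ i) A s fun i _ =>
    continuousOn_const.mul (hf.pow i)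
  rw [Finset.sum_fn] at h
  rw [h]
  refine Finset.sum_congr rfl fun i _ => ?_
  rw [cfc_const_mul (a i) (fun x => f x ^ i) A (hf.pow i), cfc_pow f i A hf]

/-- A self-adjoint operator is bounded by `g` of it times the largest ratio `x / g x`. -/
theorem le_sSup_div_smul_cfc {K : Type*} [NormedAddCommGroup K] [InnerProductSpace ℂ K]
    [CompleteSpace K] {B : K →L[ℂ] K} (hB : IsSelfAdjoint B) {S : Set ℝ} (hS : IsCompact S)
    (hBS : spectrum ℝ B ⊆ S) {g : ℝ → ℝ} (hg : ContinuousOn g S) (hgpos : ∀ x ∈ S, 0 < g x) :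
    B ≤ (sSup ((fun x => x / g x) '' S)) • cfc g B := by
  have hbdd : BddAbove ((fun x => x / g x) '' S) :=
    (hS.image_of_continuousOn
      (continuousOn_id.div hg fun x hx => (hgpos x hx).ne')).bddAbove
  rw [← cfc_const_mul _ g B (hg.mono hBS)]
  conv_lhs => rw [← cfc_id' ℝ B]
  refine cfc_mono (fun x hx => ?_) continuousOn_id (continuousOn_const.mul (hg.mono hBS))
  rw [← div_le_iff₀ (hgpos x (hBS hx))]
  exact le_csSup hbdd (Set.mem_image_of_mem _ (hBS hx))

/-- Bounding a polynomial in `y` from above, term by term according to the signs of the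
coefficients. -/
theorem sum_mul_pow_le_of_mem_Icc {l y u : ℝ} (hl : 0 ≤ l) (hly : l ≤ y) (hyu : y ≤ u)
    (s : Finset ℕ) (a c d : ℕ → ℝ) (hc : ∀ i, 1 ≤ c i) (hd : ∀ i, 1 ≤ d i) :
    ∑ i ∈ s, a i * y ^ i ≤
      (∑ i ∈ s.filter (fun i => 0 ≤ a i), a i * c i * u ^ i) +
        ∑ i ∈ s.filter (fun i => a i < 0), a i * (d i)⁻¹ * l ^ i := by
  rw [← Finset.sum_filter_add_sum_filter_not s (fun i => 0 ≤ a i)]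
  simp_rw [not_le]
  refine add_le_add (Finset.sum_le_sum fun i hi => ?_) (Finset.sum_le_sum fun i hi => ?_)
  · rw [mul_assoc]
    refine mul_le_mul_of_nonneg_left ?_ (Finset.mem_filter.1 hi).2
    exact (pow_le_pow_left₀ (hl.trans hly) hyu i).trans
      (le_mul_of_one_le_left (pow_nonneg (hl.trans (hly.trans hyu)) i) (hc i))
  · rw [mul_assoc]
    refine mul_le_mul_of_nonpos_left ?_ (Finset.mem_filter.1 hi).2.le
    exact (mul_le_of_le_one_left (pow_nonneg hl i) (inv_le_one_of_one_le₀ (hd i))).trans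
      (pow_le_pow_left₀ hl hly i)

theorem stmt7
    {H K : Type*} [NormedAddCommGroup H] [InnerProductSpace ℂ H] [CompleteSpace H]
    [NormedAddCommGroup K] [InnerProductSpace ℂ K] [CompleteSpace K]
    (V : K →L[ℂ] H) (hV : (adjoint V) ∘L V = 1)
    (I : ℕ) (a : ℕ → ℝ)
    (k : ℕ) (hk : 1 ≤ k)
    (w : Fin k → ℝ) (hw : ∀ j, 0 ≤ w j) (hw1 : ∑ j, w j = 1)
    (m M : Fin k → ℝ) (hmM : ∀ j, m j < M j)
    (A : Fin k → H →L[ℂ] H) (hA : ∀ j, IsSelfAdjoint (A j))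
    (hspec : ∀ j, spectrum ℝ (A j) ⊆ Set.Icc (m j) (M j))
    (f : ℝ → ℝ) (hf : ContinuousOn f (⋃ j, Set.Icc (m j) (M j)))
    (pL pU : Polynomial ℝ)
    (hp : ∀ x ∈ ⋃ j, Set.Icc (m j) (M j),
      0 < pL.eval x ∧ pL.eval x ≤ f x ∧ f x ≤ pU.eval x)
    (mU MU mL ML : Fin k → ℝ)
    (hmU : ∀ j, mU j = sInf ((fun x => pU.eval x) '' Set.Icc (m j) (M j)))
    (hMU : ∀ j, MU j = sSup ((fun x => pU.eval x) '' Set.Icc (m j) (M j)))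
    (hmL : ∀ j, mL j = sInf ((fun x => pL.eval x) '' Set.Icc (m j) (M j)))
    (hML : ∀ j, ML j = sSup ((fun x => pL.eval x) '' Set.Icc (m j) (M j)))
    (hUlt : ∀ j, mU j < MU j) (hLlt : ∀ j, mL j < ML j)
    (qU qL : Fin k → ℝ → ℝ)
    (hqU : ∀ j x, qU j x =
      (∑ i ∈ (Finset.range (I + 1)).filter (fun i => 0 ≤ a i),
        a i * kantorovich (mU j) (MU j) (i : ℝ) * (pU.eval x) ^ i) +
      ∑ i ∈ (Finset.range (I + 1)).filter (fun i => a i < 0),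
        a i * (kantorovich (mL j) (ML j) (i : ℝ))⁻¹ * (pL.eval x) ^ i)
    (hqL : ∀ j x, qL j x =
      (∑ i ∈ (Finset.range (I + 1)).filter (fun i => 0 ≤ a i),
        a i * (kantorovich (mL j) (ML j) (i : ℝ))⁻¹ * (pL.eval x) ^ i) +
      ∑ i ∈ (Finset.range (I + 1)).filter (fun i => a i < 0),
        a i * kantorovich (mU j) (MU j) (i : ℝ) * (pU.eval x) ^ i)
    (BU BL : K →L[ℂ] K)
    (hBU : BU = ∑ j, w j • ((adjoint V) ∘L (cfc (qU j) (A j)) ∘L V))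
    (hBL : BL = ∑ j, w j • ((adjoint V) ∘L (cfc (qL j) (A j)) ∘L V))
    (SU SL : Set ℝ)
    (hSU : SU = closure (convexHull ℝ (⋃ j, qU j '' Set.Icc (m j) (M j))))
    (hSL : SL = closure (convexHull ℝ (⋃ j, qL j '' Set.Icc (m j) (M j))))
    (g : ℝ → ℝ) (hg : ContinuousOn g SU) (hgpos : ∀ x ∈ SU, 0 < g x) :
    (∑ j, w j • ((adjoint V) ∘L (∑ i ∈ Finset.range (I + 1), a i • (cfc f (A j)) ^ i) ∘L V)) ≤
      (sSup ((fun x => x / g x) '' SU)) • cfc g BU := by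
  have hIcc : ∀ j, Set.Icc (m j) (M j) ⊆ ⋃ j, Set.Icc (m j) (M j) :=
    Set.subset_iUnion fun j => Set.Icc (m j) (M j)
  have hmUpos : ∀ j, 0 < mU j := fun j => hmU j ▸ sInf_eval_image_Icc_pos (hmM j).le
    fun x hx => have h := hp x (hIcc j hx); h.1.trans_le (h.2.1.trans h.2.2)
  have hmLpos : ∀ j, 0 < mL j := fun j => hmL j ▸ sInf_eval_image_Icc_pos (hmM j).le
    fun x hx => (hp x (hIcc j hx)).1
  have hqc : ∀ j, Continuous (qU j) := fun j => by
    rw [funext (hqU j)]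
    fun_prop
  have hqsa : ∀ j, IsSelfAdjoint (cfc (qU j) (A j)) := fun j => cfc_predicate _ _
  have hBUsa : IsSelfAdjoint BU :=
    hBU ▸ isSelfAdjoint_sum_smul_adjoint_comp_comp Finset.univ V w hqsa
  have hscompact : IsCompact (⋃ j, qU j '' Set.Icc (m j) (M j)) :=
    isCompact_iUnion fun j => isCompact_Icc.image (hqc j)
  have hScompact : IsCompact SU := by
    rw [hSU]
    exact (isBounded_convexHull.2 hscompact.isBounded).isCompact_closure
  have hsub : ∀ j, ∀ x ∈ Set.Icc (m j) (M j), qU j x ∈ SU := fun j x hx => by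
    rw [hSU]
    exact subset_closure (subset_convexHull ℝ _ (Set.mem_iUnion.2 ⟨j, x, hx, rfl⟩))
  have hSconn : IsConnected SU := by
    have hne : SU.Nonempty := ⟨_, hsub ⟨0, hk⟩ _ (Set.left_mem_Icc.2 (hmM _).le)⟩
    refine Convex.isConnected ?_ hne
    rw [hSU]
    exact (convex_convexHull ℝ _).closure
  have hSIcc : SU = Set.Icc (sInf SU) (sSup SU) := eq_Icc_of_connected_compact hSconn hScompact
  have hbounds : ∀ j, ∀ x ∈ spectrum ℝ (A j), qU j x ∈ Set.Icc (sInf SU) (sSup SU) :=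
    fun j x hx => hSIcc ▸ hsub j x (hspec j hx)
  have hspecBU : spectrum ℝ BU ⊆ SU := by
    rw [hSIcc, hBU]
    exact spectrum_sum_smul_adjoint_comp_comp_subset_Icc Finset.univ V hV hw hw1 hqsa
      (fun j => algebraMap_le_cfc _ _ _ (fun x hx => (hbounds j x hx).1)
        (hqc j).continuousOn (hA j))
      (fun j => cfc_le_algebraMap _ _ _ (fun x hx => (hbounds j x hx).2)
        (hqc j).continuousOn (hA j))
  refine le_trans ?_ (le_sSup_div_smul_cfc hBUsa hScompact hspecBU hg hgpos)
  rw [hBU]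
  refine sum_smul_adjoint_comp_comp_mono Finset.univ V hw fun j => ?_
  have hfj : ContinuousOn f (spectrum ℝ (A j)) := hf.mono ((hspec j).trans (hIcc j))
  rw [sum_smul_cfc_pow (hA j) hfj]
  refine cfc_mono (fun x hx => ?_) (by fun_prop) (hqc j).continuousOn
  obtain ⟨h0, h1, h2⟩ := hp x (hIcc j (hspec j hx))
  rw [hqU]
  exact sum_mul_pow_le_of_mem_Icc h0.le h1 h2 _ a _ _
    (fun i => one_le_kantorovich_natCast (hmUpos j) (hUlt j) i)
    (fun i => one_le_kantorovich_natCast (hmLpos j) (hLlt j) i)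
end
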